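/- Let d ∈ {3,4} and let P be the law of a random traps environment ρ = (ρ_x)_{x∈ℤ^d} which is stationary under the shifts of ℤ^d, satisfies E[π_ρ(0)] < ∞ where π_ρ(x) = (1−ρ_x)^{-1}, and satisfies: there exist R₀, K₀ > 0 such that E[π_ρ(x)π_ρ(y)] ≤ K₀ whenever |x−y| > R₀. Then for every R > 0 there exists c > 0 such that for all m ≥ 2: E[ ∑_{x,y∈Λ_m} g(0,x)² g(0,y)² π_ρ(x) π_ρ(y) · 1_{π_ρ(x) ≤ R·max(|x|,1)²} · 1_{π_ρ(y) ≤ R·max(|y|,1)²} ] ≤ c·m² if d = 3, and ≤ c·(log m)² if d = 4, where g is the Green's function of the simple random walk on ℤ^d. -/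

import Mathlib

open MeasureTheory
open scoped ENNReal NNReal Classical

noncomputable section

/-- The lattice `ℤ^d`. -/
abbrev Zd (d : ℕ) := Fin d → ℤ

/-- Euclidean norm of a lattice point. -/
def znorm {d : ℕ} (x : Zd d) : ℝ := Real.sqrt (∑ i, ((x i : ℝ)) ^ 2)

/-- Matrix powers of a (sub-)stochastic kernel on `ℤ^d`, valued in `[0,∞]`. -/
def kpow {d : ℕ} (p : Zd d → Zd d → ℝ≥0∞) : ℕ → Zd d → Zd d → ℝ≥0∞
  | 0 => fun x y => if x = y then 1 else 0
  | n + 1 => fun x y => ∑' z : Zd d, kpow p n x z * p z y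

/-- Transition kernel of the simple random walk on `ℤ^d`. -/
def srwK (d : ℕ) (x y : Zd d) : ℝ≥0∞ :=
  if znorm (x - y) = 1 then (2 * (d : ℝ≥0∞))⁻¹ else 0

/-- Green's function of the simple random walk on `ℤ^d`. -/
def gSRW (d : ℕ) (x y : Zd d) : ℝ≥0∞ := ∑' n : ℕ, kpow (srwK d) n x y

/-- The box `Λ_m = ℤ^d ∩ [-m,m]^d`. -/
def lamF (d m : ℕ) : Finset (Zd d) := Fintype.piFinset fun _ => Finset.Icc (-(m : ℤ)) (m : ℤ)

/-- `π_ρ(x) = (1-ρ_x)⁻¹`, as an extended real. -/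
def piT {d : ℕ} (ρ : Zd d → ℝ) (x : Zd d) : ℝ≥0∞ := ENNReal.ofReal ((1 - ρ x)⁻¹)

/-- Indicator of the event `π_ρ(x) ≤ R·max(|x|,1)²`. -/
def smallTrap {d : ℕ} (R : ℝ) (ρ : Zd d → ℝ) (x : Zd d) : ℝ≥0∞ :=
  if (1 - ρ x)⁻¹ ≤ R * max (znorm x) 1 ^ 2 then 1 else 0


/-- Nonnegative real recursion for the `n`-step transition probabilities from the origin. -/
def heat (d : ℕ) : ℕ → Zd d → ℝ≥0
  | 0 => fun x => if x = 0 then 1 else 0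
  | n + 1 => fun x =>
      (2 * (d : ℝ≥0))⁻¹ * ∑ i, (heat d n (x + Pi.single i 1) + heat d n (x - Pi.single i 1))

/-- The squared Euclidean norm of a lattice point, as a natural number. -/
def sqNorm {d : ℕ} (x : Zd d) : ℕ := ∑ i, (x i).natAbs ^ 2

lemma sqNorm_cast {d : ℕ} (x : Zd d) : (sqNorm x : ℝ) = znorm x ^ 2 := by
  rw [znorm, Real.sq_sqrt (Finset.sum_nonneg fun i _ => sq_nonneg _), sqNorm]
  push_cast
  refine Finset.sum_congr rfl fun i _ => ?_
  rw [Nat.cast_natAbs]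
  push_cast
  exact sq_abs _

lemma sqNorm_cast_int {d : ℕ} (x : Zd d) : (sqNorm x : ℤ) = ∑ i, x i ^ 2 := by
  rw [sqNorm]
  push_cast
  exact Finset.sum_congr rfl fun i _ => sq_abs _

lemma exists_single_of_sqNorm_eq_one {d : ℕ} {x : Zd d} (h : sqNorm x = 1) :
    ∃ i, x = Pi.single i 1 ∨ x = -Pi.single i 1 := by
  have hne : ∃ i, x i ≠ 0 := by
    by_contra! hx
    simp [sqNorm, hx] at h
  obtain ⟨i, hi⟩ := hne
  have hsplit := Finset.add_sum_erase Finset.univ (fun j => (x j).natAbs ^ 2) (Finset.mem_univ i)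
  have h1 : 1 ≤ (x i).natAbs ^ 2 := Nat.one_le_pow _ _ (Int.natAbs_pos.2 hi)
  change _ = sqNorm x at hsplit
  rw [h] at hsplit
  have h0 : ∑ j ∈ Finset.univ.erase i, (x j).natAbs ^ 2 = 0 := by
    omega
  have hz : ∀ j, j ≠ i → x j = 0 := fun j hj => by
    have := (Finset.sum_eq_zero_iff.1 h0) j (by simp [hj])
    simpa using this
  have hsq : (x i).natAbs ^ 2 = 1 := by
    omega
  have hab : (x i).natAbs = 1 := by simpa using hsq
  refine ⟨i, ?_⟩
  rcases Int.natAbs_eq (x i) with h2 | h2 <;> rw [hab] at h2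
  · left
    ext j
    by_cases hj : j = i
    · subst hj; simpa using h2
    · simp [hj, hz j hj]
  · right
    ext j
    by_cases hj : j = i
    · subst hj; simpa using h2
    · simp [hj, hz j hj]

lemma srwK_le {d : ℕ} (z x : Zd d) :
    srwK d z x ≤ (2 * (d : ℝ≥0∞))⁻¹ *
      ∑ i, ((if z = x + Pi.single i 1 then 1 else 0) + if z = x - Pi.single i 1 then 1 else 0) := by
  unfold srwK
  split_ifs with h
  · have h1 : sqNorm (z - x) = 1 := by
      have := sqNorm_cast (z - x)
      rw [h] at this
      rw [one_pow] at this
      exact_mod_cast this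
    obtain ⟨i, hi⟩ := exists_single_of_sqNorm_eq_one h1
    refine le_mul_of_one_le_right zero_le ?_
    refine le_trans ?_ (Finset.single_le_sum (fun _ _ => zero_le) (Finset.mem_univ i))
    rcases hi with hi | hi
    · rw [if_pos (by rw [← hi]; abel)]
      exact le_self_add
    · rw [if_pos (c := z = x - _) (by rw [sub_eq_add_neg, ← hi]; abel)]
      exact le_add_self
  · exact zero_le

lemma kpow_srwK_le_heat {d : ℕ} (hd : 0 < d) (n : ℕ) (x : Zd d) :
    kpow (srwK d) n 0 x ≤ heat d n x := by
  induction n generalizing x with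
  | zero =>
    simp only [kpow, heat, eq_comm (a := x)]
    split_ifs <;> simp
  | succ n ih =>
    have hinv : ((2 * (d : ℝ≥0))⁻¹ : ℝ≥0) = (2 * (d : ℝ≥0∞))⁻¹ := by
      rw [ENNReal.coe_inv (by positivity)]
      push_cast
      rfl
    calc kpow (srwK d) (n + 1) 0 x
        ≤ ∑' z, (heat d n z : ℝ≥0∞) * ((2 * (d : ℝ≥0∞))⁻¹ * ∑ i,
            ((if z = x + Pi.single i 1 then 1 else 0) +
              if z = x - Pi.single i 1 then 1 else 0)) := by
          rw [kpow]
          exact ENNReal.tsum_le_tsum fun z => mul_le_mul' (ih z) (srwK_le z x)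
      _ = (2 * (d : ℝ≥0∞))⁻¹ * ∑ i, ∑' z, ((heat d n z : ℝ≥0∞) *
            (if z = x + Pi.single i 1 then 1 else 0) +
              heat d n z * if z = x - Pi.single i 1 then 1 else 0) := by
          rw [← Summable.tsum_finsetSum fun i _ => ENNReal.summable, ← ENNReal.tsum_mul_left]
          refine tsum_congr fun z => ?_
          rw [mul_left_comm, Finset.mul_sum]
          simp only [mul_add]
      _ = heat d (n + 1) x := by
          rw [heat]
          push_cast
          rw [hinv]
          simp [ENNReal.tsum_add]

lemma heat_neg {d : ℕ} (n : ℕ) (x : Zd d) : heat d n (-x) = heat d n x := by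
  induction n generalizing x with
  | zero => simp [heat]
  | succ n ih =>
    simp only [heat]
    congr 1
    refine Finset.sum_congr rfl fun i _ => ?_
    rw [← ih (x + _), ← ih (x - _), add_comm]
    congr 2 <;> abel

lemma heat_add {d : ℕ} (m n : ℕ) (x : Zd d) :
    (heat d (m + n) x : ℝ≥0∞) = ∑' z, (heat d m z : ℝ≥0∞) * heat d n (x - z) := by
  induction n generalizing x with
  | zero =>
    rw [tsum_eq_single x]
    · simp [heat]
    · intro z hz
      simp [heat, sub_eq_zero, hz.symm]
  | succ n ih =>
    rw [← add_assoc]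
    simp only [heat]
    push_cast
    simp only [ih, ← ENNReal.tsum_add]
    rw [← Summable.tsum_finsetSum (fun _ _ => ENNReal.summable), ← ENNReal.tsum_mul_left]
    refine tsum_congr fun z => ?_
    rw [mul_left_comm]
    congr 1
    rw [Finset.mul_sum]
    refine Finset.sum_congr rfl fun i _ => ?_
    rw [mul_add, sub_add_eq_add_sub, sub_right_comm]

lemma tsum_heat_succ_mul {d : ℕ} (n : ℕ) (w : Zd d → ℝ≥0∞) :
    ∑' x, (heat d (n + 1) x : ℝ≥0∞) * w x = ∑' x, (heat d n x : ℝ≥0∞) *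
      (((2 * (d : ℝ≥0))⁻¹ : ℝ≥0) * ∑ i, (w (x + Pi.single i 1) + w (x - Pi.single i 1))) := by
  simp only [heat]
  push_cast
  simp only [mul_assoc, mul_left_comm (heat d n _ : ℝ≥0∞) _ (∑ _, _), ENNReal.tsum_mul_left]
  congr 1
  simp only [Finset.sum_mul, Finset.mul_sum, add_mul, mul_add]
  rw [Summable.tsum_finsetSum fun i _ => ENNReal.summable,
    Summable.tsum_finsetSum fun i _ => ENNReal.summable]
  refine Finset.sum_congr rfl fun i _ => ?_
  rw [ENNReal.tsum_add, ENNReal.tsum_add, add_comm]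
  congr 1
  · rw [← (Equiv.addRight (Pi.single i 1 : Zd d)).tsum_eq]
    simp
  · rw [← (Equiv.subRight (Pi.single i 1 : Zd d)).tsum_eq]
    simp

lemma sqNorm_add_single {d : ℕ} (x : Zd d) (i : Fin d) :
    sqNorm (x + Pi.single i 1) + sqNorm (x - Pi.single i 1) = 2 * sqNorm x + 2 := by
  zify
  simp only [sqNorm_cast_int, Pi.add_apply, Pi.sub_apply, ← Finset.sum_add_distrib]
  have h : ∀ j, (x j + (Pi.single i 1 : Zd d) j) ^ 2 + (x j - (Pi.single i 1 : Zd d) j) ^ 2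
      = 2 * x j ^ 2 + if j = i then 2 else 0 := by
    intro j
    by_cases hj : j = i
    · subst hj; simp; ring
    · simp [hj]; ring
  simp [h, Finset.sum_add_distrib, Finset.mul_sum]

lemma average_const {d : ℕ} (hd : 0 < d) (a : ℝ≥0∞) :
    (((2 * (d : ℝ≥0))⁻¹ : ℝ≥0) : ℝ≥0∞) * ∑ _i : Fin d, 2 * a = a := by
  have h : (((2 * (d : ℝ≥0))⁻¹ : ℝ≥0) : ℝ≥0∞) * (d * 2 : ℝ≥0) = 1 := by
    rw [← ENNReal.coe_mul, mul_comm (d : ℝ≥0), inv_mul_cancel₀ (by positivity)]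
    rfl
  push_cast at h
  simp only [Finset.sum_const, Finset.card_univ, Fintype.card_fin, nsmul_eq_mul]
  rw [← mul_assoc, ← mul_assoc, mul_assoc _ (d : ℝ≥0∞), h, one_mul]

lemma tsum_heat {d : ℕ} (hd : 0 < d) (n : ℕ) : ∑' x, (heat d n x : ℝ≥0∞) = 1 := by
  induction n with
  | zero =>
    rw [tsum_eq_single 0] <;> simp +contextual [heat]
  | succ n ih =>
    have h := tsum_heat_succ_mul (d := d) n fun _ => 1
    have h2 := average_const hd 1
    norm_num [one_add_one_eq_two] at h h2
    rw [h2] at h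
    simpa [ih] using h

lemma tsum_heat_mul_sqNorm {d : ℕ} (hd : 0 < d) (n : ℕ) :
    ∑' x, (heat d n x : ℝ≥0∞) * sqNorm x = n := by
  induction n with
  | zero =>
    rw [tsum_eq_single 0] <;> simp +contextual [heat, sqNorm]
  | succ n ih =>
    rw [tsum_heat_succ_mul]
    have h : ∀ (x : Zd d) i, ((sqNorm (x + Pi.single i 1) : ℕ) : ℝ≥0∞)
        + (sqNorm (x - Pi.single i 1) : ℕ) = 2 * (sqNorm x + 1) := fun x i => by
      exact_mod_cast (sqNorm_add_single x i).trans (by ring)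
    simp only [h, average_const hd]
    simp only [mul_add, ENNReal.tsum_add, ih, mul_one, tsum_heat hd]
    push_cast
    rfl

/-- Lebesgue measure on the torus `(-π, π]^d`. -/
def torusMeasure (d : ℕ) : Measure (Fin d → ℝ) :=
  Measure.pi fun _ => volume.restrict (Set.Ioc (-Real.pi) Real.pi)

instance (d : ℕ) : IsFiniteMeasure (torusMeasure d) := by
  unfold torusMeasure
  infer_instance

/-- The character of the torus with frequency `x`. -/
def torusChar {d : ℕ} (x : Zd d) (θ : Fin d → ℝ) : ℂ :=
  ∏ j, Complex.exp ((x j : ℂ) * θ j * Complex.I)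

/-- The characteristic function of a simple random walk step. -/
def stepChar {d : ℕ} (θ : Fin d → ℝ) : ℝ := (∑ i, Real.cos (θ i)) / d

lemma torusChar_add {d : ℕ} (x y : Zd d) (θ : Fin d → ℝ) :
    torusChar (x + y) θ = torusChar x θ * torusChar y θ := by
  simp only [torusChar, ← Finset.prod_mul_distrib, ← Complex.exp_add, Pi.add_apply]
  refine Finset.prod_congr rfl fun j _ => ?_
  push_cast
  ring_nf

lemma torusChar_single {d : ℕ} (i : Fin d) (a : ℤ) (θ : Fin d → ℝ) :
    torusChar (Pi.single i a) θ = Complex.exp (a * θ i * Complex.I) := by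
  rw [torusChar, Finset.prod_eq_single i]
  · simp
  · intro j _ hj
    simp [hj]
  · simp

lemma norm_torusChar {d : ℕ} (x : Zd d) (θ : Fin d → ℝ) : ‖torusChar x θ‖ = 1 := by
  rw [torusChar, norm_prod]
  refine Finset.prod_eq_one fun j _ => ?_
  exact_mod_cast Complex.norm_exp_ofReal_mul_I (x j * θ j)

lemma continuous_torusChar {d : ℕ} (x : Zd d) : Continuous (torusChar x) := by
  unfold torusChar
  fun_prop

lemma continuous_stepChar {d : ℕ} : Continuous (stepChar (d := d)) := by
  unfold stepChar
  fun_prop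

lemma abs_stepChar_le_one {d : ℕ} (θ : Fin d → ℝ) : |stepChar θ| ≤ 1 := by
  rw [stepChar, abs_div, Nat.abs_cast]
  refine div_le_one_of_le₀ ?_ (by positivity)
  refine (Finset.abs_sum_le_sum_abs _ _).trans ?_
  refine (Finset.sum_le_sum fun i _ => Real.abs_cos_le_one (θ i)).trans ?_
  simp

lemma integrable_stepChar_pow_mul_torusChar {d : ℕ} (n : ℕ) (x : Zd d) :
    Integrable (fun θ => (stepChar θ : ℂ) ^ n * torusChar x θ) (torusMeasure d) := by
  refine Integrable.of_bound (C := 1) ?_ (Filter.Eventually.of_forall fun θ => ?_)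
  · have h1 := continuous_torusChar x
    have h2 := continuous_stepChar (d := d)
    exact Continuous.aestronglyMeasurable (by fun_prop)
  · rw [norm_mul, norm_torusChar, mul_one, norm_pow, Complex.norm_real, Real.norm_eq_abs]
    exact pow_le_one₀ (abs_nonneg _) (abs_stepChar_le_one θ)

lemma stepChar_mul_torusChar {d : ℕ} (x : Zd d) (θ : Fin d → ℝ) :
    (stepChar θ : ℂ) * torusChar x θ = (2 * (d : ℂ))⁻¹ *
      ∑ i, (torusChar (x + Pi.single i 1) θ + torusChar (x - Pi.single i 1) θ) := by
  have h : ∀ i, torusChar (x + Pi.single i 1) θ + torusChar (x - Pi.single i 1) θ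
      = 2 * (Complex.cos (θ i) * torusChar x θ) := fun i => by
    rw [sub_eq_add_neg, ← Pi.single_neg, torusChar_add, torusChar_add, torusChar_single,
      torusChar_single, ← mul_assoc, Complex.two_cos]
    push_cast
    ring_nf
  simp only [h, ← Finset.mul_sum, ← Finset.sum_mul, stepChar]
  push_cast
  rw [mul_inv]
  ring

lemma integral_exp_int_mul (k : ℤ) :
    ∫ t in Set.Ioc (-Real.pi) Real.pi, Complex.exp ((k : ℂ) * t * Complex.I)
      = if k = 0 then 2 * (Real.pi : ℂ) else 0 := by
  rw [← intervalIntegral.integral_of_le (by linarith [Real.pi_pos])]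
  split_ifs with hk
  · simp [hk, two_mul]
  · have hc : (k : ℂ) * Complex.I ≠ 0 := mul_ne_zero (by exact_mod_cast hk) Complex.I_ne_zero
    simp only [mul_right_comm (k : ℂ) _ Complex.I]
    rw [integral_exp_mul_complex hc]
    have hper : Complex.exp ((k : ℂ) * Complex.I * Real.pi)
        = Complex.exp ((k : ℂ) * Complex.I * (-Real.pi : ℝ)) := by
      rw [Complex.exp_eq_exp_iff_exists_int]
      refine ⟨k, ?_⟩
      push_cast
      ring
    rw [hper, sub_self, zero_div]

lemma integral_torusChar {d : ℕ} (x : Zd d) :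
    ∫ θ, torusChar x θ ∂torusMeasure d = if x = 0 then (2 * (Real.pi : ℂ)) ^ d else 0 := by
  unfold torusChar torusMeasure
  rw [integral_fintype_prod_eq_prod (𝕜 := ℂ)
    (fun j t => Complex.exp ((x j : ℂ) * (t : ℝ) * Complex.I))]
  simp only [integral_exp_int_mul]
  split_ifs with hx
  · simp [hx]
  · obtain ⟨j, hj⟩ := Function.ne_iff.1 hx
    exact Finset.prod_eq_zero (Finset.mem_univ j) (if_neg hj)

lemma integral_stepChar_pow_mul_torusChar {d : ℕ} (n : ℕ) (x : Zd d) :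
    ∫ θ, (stepChar θ : ℂ) ^ n * torusChar x θ ∂torusMeasure d
      = (2 * (Real.pi : ℂ)) ^ d * (heat d n x : ℝ) := by
  induction n generalizing x with
  | zero =>
    simp only [pow_zero, one_mul, integral_torusChar, heat]
    split_ifs <;> simp
  | succ n ih =>
    have h : ∀ θ, (stepChar θ : ℂ) ^ (n + 1) * torusChar x θ = (2 * (d : ℂ))⁻¹ *
        ∑ i, ((stepChar θ : ℂ) ^ n * torusChar (x + Pi.single i 1) θ
          + (stepChar θ : ℂ) ^ n * torusChar (x - Pi.single i 1) θ) := fun θ => by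
      rw [pow_succ, mul_assoc, stepChar_mul_torusChar, mul_left_comm, Finset.mul_sum]
      simp only [mul_add]
    have hint := integrable_stepChar_pow_mul_torusChar (d := d) n
    have hadd : ∀ i : Fin d, Integrable (fun θ =>
        (stepChar θ : ℂ) ^ n * torusChar (x + Pi.single i 1) θ
          + (stepChar θ : ℂ) ^ n * torusChar (x - Pi.single i 1) θ) (torusMeasure d) :=
      fun i => (hint _).add (hint _)
    simp only [h]
    rw [integral_const_mul, integral_finsetSum _ fun i _ => hadd i]
    simp only [integral_add (hint _) (hint _), ih]
    simp only [heat, ← mul_add, ← Finset.mul_sum]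
    push_cast
    ring

lemma exp_neg_mul_sin_sq_le {c t : ℝ} (hc : 0 ≤ c) (ht : |t| ≤ Real.pi / 2) :
    Real.exp (-(c * Real.sin t ^ 2)) ≤ Real.exp (-(c * (2 / Real.pi) ^ 2) * t ^ 2) := by
  rw [Real.exp_le_exp, neg_mul, neg_le_neg_iff, mul_assoc, ← sq_abs t, ← mul_pow,
    ← sq_abs (Real.sin t)]
  gcongr
  exact Real.mul_abs_le_abs_sin ht

lemma setIntegral_exp_neg_mul_sin_sq_le {c : ℝ} (hc : 0 < c) :
    ∫ t in Set.Ioc (-Real.pi) Real.pi, Real.exp (-(c * Real.sin t ^ 2))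
      ≤ 3 * √(Real.pi / (c * (2 / Real.pi) ^ 2)) := by
  have hpi := Real.pi_pos
  set b := c * (2 / Real.pi) ^ 2 with hb
  have hb0 : 0 < b := by positivity
  set G : ℝ → ℝ := fun t => Real.exp (-b * t ^ 2) with hG
  have hGi : Integrable G := integrable_exp_neg_mul_sq hb0
  have hG0 : ∀ t, 0 ≤ G t := fun t => (Real.exp_pos _).le
  have hsum' : Integrable fun t => G t + G (t - Real.pi) := hGi.add (hGi.comp_sub_right _)
  have hsum : Integrable fun t => G t + G (t - Real.pi) + G (t + Real.pi) :=
    hsum'.add (hGi.comp_add_right _)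
  calc ∫ t in Set.Ioc (-Real.pi) Real.pi, Real.exp (-(c * Real.sin t ^ 2))
      ≤ ∫ t in Set.Ioc (-Real.pi) Real.pi, (G t + G (t - Real.pi) + G (t + Real.pi)) := by
        refine setIntegral_mono_on ?_ hsum.integrableOn measurableSet_Ioc ?_
        · exact (Continuous.integrableOn_Icc (by fun_prop)).mono_set Set.Ioc_subset_Icc_self
        · intro t ht
          rcases le_total |t| (Real.pi / 2) with h | h
          · linarith [exp_neg_mul_sin_sq_le hc.le h, hG0 (t - Real.pi), hG0 (t + Real.pi)]
          rcases le_total 0 t with h0 | h0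
          · rw [abs_of_nonneg h0] at h
            have h1 := exp_neg_mul_sin_sq_le hc.le (t := t - Real.pi)
              (abs_le.2 ⟨by linarith, by linarith [ht.2]⟩)
            rw [Real.sin_sub_pi, neg_sq] at h1
            linarith [hG0 t, hG0 (t + Real.pi)]
          · rw [abs_of_nonpos h0] at h
            have h1 := exp_neg_mul_sin_sq_le hc.le (t := t + Real.pi)
              (abs_le.2 ⟨by linarith [ht.1], by linarith⟩)
            rw [Real.sin_add_pi, neg_sq] at h1
            linarith [hG0 t, hG0 (t - Real.pi)]
    _ ≤ ∫ t, (G t + G (t - Real.pi) + G (t + Real.pi)) :=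
        setIntegral_le_integral hsum (Filter.Eventually.of_forall fun t =>
          add_nonneg (add_nonneg (hG0 _) (hG0 _)) (hG0 _))
    _ = 3 * √(Real.pi / b) := by
        rw [integral_add hsum' (hGi.comp_add_right _),
          integral_add hGi (hGi.comp_sub_right _), integral_sub_right_eq_self G,
          integral_add_right_eq_self G, integral_gaussian]
        ring

lemma abs_stepChar_le_prod {d : ℕ} (hd : 0 < d) (θ : Fin d → ℝ) :
    |stepChar θ| ≤ ∏ i, Real.exp (-(Real.sin (θ i) ^ 2 / (2 * d))) := by
  have hd' : (0 : ℝ) < d := by exact_mod_cast hd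
  rw [← Real.exp_sum]
  refine le_trans ?_ (Real.add_one_le_exp _)
  have h : ∀ i, |Real.cos (θ i)| ≤ 1 - Real.sin (θ i) ^ 2 / 2 := fun i => by
    have h1 := Real.sin_sq_add_cos_sq (θ i)
    rw [← sq_abs (Real.cos _)] at h1
    nlinarith [sq_nonneg (|Real.cos (θ i)| - 1)]
  calc |stepChar θ| ≤ (∑ i, |Real.cos (θ i)|) / d := by
        rw [stepChar, abs_div, Nat.abs_cast]
        gcongr
        exact Finset.abs_sum_le_sum_abs _ _
    _ ≤ (∑ i : Fin d, (1 - Real.sin (θ i) ^ 2 / 2)) / d := by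
        gcongr with i
        exact h i
    _ = _ := by
        rw [Finset.sum_sub_distrib, Finset.sum_neg_distrib, ← Finset.sum_div, ← Finset.sum_div]
        simp
        field_simp
        ring

/-- The sequence `(n + 1)^(-1/2)`. -/
def invSqrt (n : ℕ) : ℝ≥0 := (NNReal.sqrt (n + 1))⁻¹

/-- On-diagonal decay of the heat kernel. -/
lemma exists_heat_le {d : ℕ} (hd : 0 < d) :
    ∃ A : ℝ≥0, ∀ n x, heat d n x ≤ A * invSqrt n ^ d := by
  have hpi := Real.pi_pos
  have hd' : (1 : ℝ) ≤ d := by exact_mod_cast hd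
  set K : ℝ := Real.exp 1 * (3 * √(Real.pi / ((2 * d : ℝ)⁻¹ * (2 / Real.pi) ^ 2))) with hK
  have hone : ∀ n : ℕ, ∫ t in Set.Ioc (-Real.pi) Real.pi,
      Real.exp (-(Real.sin t ^ 2 / (2 * d))) ^ n ≤ K * (√((n : ℝ) + 1))⁻¹ := fun n => by
    calc ∫ t in Set.Ioc (-Real.pi) Real.pi, Real.exp (-(Real.sin t ^ 2 / (2 * d))) ^ n
        ≤ ∫ t in Set.Ioc (-Real.pi) Real.pi, Real.exp 1 *
            Real.exp (-(((n : ℝ) + 1) * (2 * d : ℝ)⁻¹ * Real.sin t ^ 2)) := by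
          refine setIntegral_mono ?_ ?_ fun t => ?_
          · exact (Continuous.integrableOn_Icc (by fun_prop)).mono_set Set.Ioc_subset_Icc_self
          · exact (Continuous.integrableOn_Icc (by fun_prop)).mono_set Set.Ioc_subset_Icc_self
          · simp only
            rw [← Real.exp_nat_mul, ← Real.exp_add, Real.exp_le_exp]
            have h1 : Real.sin t ^ 2 / (2 * d) ≤ 1 :=
              div_le_one_of_le₀ (by linarith [Real.sin_sq_le_one t]) (by positivity)
            have h2 : ((n : ℝ) + 1) * (2 * d : ℝ)⁻¹ * Real.sin t ^ 2
              = n * (Real.sin t ^ 2 / (2 * d)) + Real.sin t ^ 2 / (2 * d) := by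
                rw [div_eq_mul_inv]; ring
            linarith
      _ ≤ Real.exp 1 * (3 * √(Real.pi / (((n : ℝ) + 1) * (2 * d : ℝ)⁻¹ * (2 / Real.pi) ^ 2))) := by
          rw [integral_const_mul]
          gcongr
          exact setIntegral_exp_neg_mul_sin_sq_le (by positivity)
      _ = K * (√((n : ℝ) + 1))⁻¹ := by
          rw [hK, mul_assoc ((n : ℝ) + 1), mul_comm ((n : ℝ) + 1), ← div_div,
            Real.sqrt_div' _ (by positivity : (0 : ℝ) ≤ (n : ℝ) + 1)]
          ring
  have hmain : ∀ n x, (heat d n x : ℝ) * (2 * Real.pi) ^ d ≤ (K * (√((n : ℝ) + 1))⁻¹) ^ d := by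
    intro n x
    have h := congrArg norm (integral_stepChar_pow_mul_torusChar (d := d) n x)
    have hr : ‖(2 * (Real.pi : ℂ)) ^ d * (heat d n x : ℝ)‖ = heat d n x * (2 * Real.pi) ^ d := by
      rw [norm_mul, norm_pow, norm_mul, Complex.norm_real, Complex.norm_real, mul_comm]
      simp [abs_of_pos hpi]
    rw [← hr, ← h]
    calc _ ≤ ∫ θ, ∏ i, Real.exp (-(Real.sin (θ i) ^ 2 / (2 * d))) ^ n ∂torusMeasure d := by
          refine norm_integral_le_of_norm_le ?_ (Filter.Eventually.of_forall fun θ => ?_)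
          · refine Integrable.fintype_prod
              (f := fun _ t => Real.exp (-(Real.sin t ^ 2 / (2 * d))) ^ n) fun i => ?_
            exact (Continuous.integrableOn_Icc (by fun_prop)).mono_set Set.Ioc_subset_Icc_self
          · rw [norm_mul, norm_torusChar, mul_one, norm_pow, Complex.norm_real,
              Real.norm_eq_abs, Finset.prod_pow]
            gcongr
            exact abs_stepChar_le_prod hd θ
      _ = (∫ t in Set.Ioc (-Real.pi) Real.pi,
            Real.exp (-(Real.sin t ^ 2 / (2 * d))) ^ n) ^ d := by
          unfold torusMeasure
          rw [integral_fintype_prod_eq_prod (𝕜 := ℝ)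
            (fun _ t => Real.exp (-(Real.sin t ^ 2 / (2 * d))) ^ n)]
          simp
      _ ≤ _ := by
          gcongr
          exact hone n
  refine ⟨((K / (2 * Real.pi)) ^ d).toNNReal, fun n x => ?_⟩
  rw [← NNReal.coe_le_coe]
  push_cast [invSqrt]
  rw [Real.coe_toNNReal _ (by positivity), ← mul_pow,
    div_mul_eq_mul_div, div_pow, le_div_iff₀ (by positivity)]
  exact hmain n x

lemma invSqrt_sq (n : ℕ) : invSqrt n ^ 2 = ((n : ℝ≥0) + 1)⁻¹ := by
  rw [invSqrt, inv_pow, NNReal.sq_sqrt]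

lemma succ_mul_invSqrt_sq (n : ℕ) : ((n : ℝ≥0) + 1) * invSqrt n ^ 2 = 1 := by
  rw [invSqrt_sq, mul_inv_cancel₀ (by positivity)]

lemma invSqrt_zero : invSqrt 0 = 1 := by simp [invSqrt]

lemma invSqrt_le_two_mul {a n : ℕ} (h : n ≤ 2 * a + 1) : invSqrt a ≤ 2 * invSqrt n := by
  rw [← pow_le_pow_iff_left₀ zero_le zero_le two_ne_zero, mul_pow, invSqrt_sq, invSqrt_sq,
    ← div_eq_mul_inv, inv_le_iff_one_le_mul₀ (by positivity), mul_comm, mul_div_assoc',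
    le_div_iff₀ (by positivity)]
  have : (n : ℝ≥0) ≤ 2 * a + 1 := by exact_mod_cast h
  calc 1 * ((n : ℝ≥0) + 1) ≤ 2 * a + 2 := by rw [one_mul]; linarith
    _ ≤ ((a : ℝ≥0) + 1) * 2 ^ 2 := by
      have h0 : (0 : ℝ≥0) ≤ a := zero_le
      linarith

lemma invSqrt_cube_add_le (n : ℕ) :
    invSqrt n ^ 3 + 4 * invSqrt (n + 1) ≤ 4 * invSqrt n := by
  have h1 := succ_mul_invSqrt_sq n
  have h2 := succ_mul_invSqrt_sq (n + 1)
  set a := invSqrt n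
  set b := invSqrt (n + 1)
  rw [← NNReal.coe_le_coe]
  replace h1 := congrArg NNReal.toReal h1
  replace h2 := congrArg NNReal.toReal h2
  push_cast at h1 h2 ⊢
  have ha : (0 : ℝ) ≤ a := a.2
  have hb : (0 : ℝ) ≤ b := b.2
  have hn : (0 : ℝ) ≤ n := n.cast_nonneg
  generalize (a : ℝ) = a at *
  generalize (b : ℝ) = b at *
  have ha1 : a ≤ 1 := by nlinarith
  have hid : a ^ 2 - b ^ 2 = a ^ 2 * b ^ 2 := by
    linear_combination b ^ 2 * h1 - a ^ 2 * h2
  have hba : b ≤ a := by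
    refine le_of_sq_le_sq ?_ ha
    nlinarith [mul_nonneg (sq_nonneg a) (sq_nonneg b)]
  have hb2 : a ^ 2 ≤ 2 * b ^ 2 := by nlinarith [sq_nonneg b]
  have ha0 : 0 < a := by
    rcases ha.eq_or_lt with h | h
    · rw [← h] at h1; norm_num at h1
    · exact h
  have key : a ^ 4 ≤ 4 * a * (a - b) := by
    calc a ^ 4 ≤ 2 * (a ^ 2 * b ^ 2) := by nlinarith [sq_nonneg a]
      _ = 2 * ((a - b) * (a + b)) := by rw [← hid]; ring
      _ ≤ 4 * a * (a - b) := by nlinarith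
  have : a * (a ^ 3) ≤ a * (4 * (a - b)) := by nlinarith
  linarith [le_of_mul_le_mul_left this ha0]

lemma invSqrt_antitone : Antitone invSqrt := by
  intro m n h
  unfold invSqrt
  gcongr

lemma invSqrt_pow_add_le {d : ℕ} (hd : 3 ≤ d) (n : ℕ) :
    invSqrt n ^ d + 4 * invSqrt (n + 1) ^ (d - 2) ≤ 4 * invSqrt n ^ (d - 2) := by
  obtain ⟨k, rfl⟩ := Nat.exists_eq_add_of_le' hd
  have h := invSqrt_cube_add_le n
  have hmono : invSqrt (n + 1) ≤ invSqrt n := invSqrt_antitone n.le_succ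
  rw [show k + 3 - 2 = k + 1 by omega]
  calc invSqrt n ^ (k + 3) + 4 * invSqrt (n + 1) ^ (k + 1)
      = invSqrt n ^ k * invSqrt n ^ 3 + 4 * (invSqrt (n + 1) ^ k * invSqrt (n + 1)) := by ring
    _ ≤ invSqrt n ^ k * invSqrt n ^ 3 + 4 * (invSqrt n ^ k * invSqrt (n + 1)) := by gcongr
    _ = invSqrt n ^ k * (invSqrt n ^ 3 + 4 * invSqrt (n + 1)) := by ring
    _ ≤ invSqrt n ^ k * (4 * invSqrt n) := by gcongr
    _ = 4 * invSqrt n ^ (k + 1) := by ring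

lemma sum_invSqrt_pow_le {d : ℕ} (hd : 3 ≤ d) (i T : ℕ) :
    ∑ n ∈ Finset.range T, invSqrt (n + i) ^ d ≤ 4 * invSqrt i ^ (d - 2) := by
  have h : ∑ n ∈ Finset.range T, invSqrt (n + i) ^ d + 4 * invSqrt (T + i) ^ (d - 2)
      ≤ 4 * invSqrt i ^ (d - 2) := by
    induction T with
    | zero => simp
    | succ T ih =>
      rw [Finset.sum_range_succ, add_assoc]
      refine le_trans ?_ ih
      gcongr
      rw [Nat.succ_add]
      exact invSqrt_pow_add_le hd _
  exact le_self_add.trans h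

lemma sqNorm_le_two_mul_add {d : ℕ} (x z : Zd d) :
    sqNorm x ≤ 2 * sqNorm z + 2 * sqNorm (x - z) := by
  zify
  simp only [sqNorm_cast_int, Finset.mul_sum, ← Finset.sum_add_distrib]
  refine Finset.sum_le_sum fun i _ => ?_
  rw [Pi.sub_apply]
  nlinarith [sq_nonneg (2 * z i - x i)]

lemma exists_sqNorm_mul_heat_le {d : ℕ} (hd : 2 ≤ d) :
    ∃ B : ℝ≥0, ∀ n (x : Zd d), sqNorm x * heat d n x ≤ B * invSqrt n ^ (d - 2) := by
  obtain ⟨A, hA⟩ := exists_heat_le (d := d) (by omega)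
  refine ⟨2 * A * 2 ^ d, fun n x => ?_⟩
  obtain ⟨a, b, hab, ha, hb⟩ : ∃ a b, n = a + b ∧ n ≤ 2 * a + 1 ∧ n ≤ 2 * b + 1 :=
    ⟨n / 2, n - n / 2, by omega, by omega, by omega⟩
  set D : ℝ≥0 := A * (2 * invSqrt n) ^ d with hD
  have hDa : ∀ z, heat d a z ≤ D := fun z => (hA a z).trans (by
    rw [hD]
    gcongr
    exact invSqrt_le_two_mul ha)
  have hDb : ∀ z, heat d b z ≤ D := fun z => (hA b z).trans (by
    rw [hD]
    gcongr
    exact invSqrt_le_two_mul hb)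
  have hshift : ∑' z, (heat d b (x - z) : ℝ≥0∞) * sqNorm (x - z) = b := by
    rw [← tsum_heat_mul_sqNorm (d := d) (by omega) b]
    exact (Equiv.subLeft x).tsum_eq fun z => (heat d b z : ℝ≥0∞) * sqNorm z
  have hle : ((sqNorm x * heat d n x : ℝ≥0) : ℝ≥0∞) ≤ (2 * D * n : ℝ≥0) := by
    push_cast
    calc (sqNorm x : ℝ≥0∞) * heat d n x
        = ∑' z, (sqNorm x : ℝ≥0∞) * (heat d a z * heat d b (x - z)) := by
          rw [hab, heat_add, ENNReal.tsum_mul_left]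
      _ ≤ ∑' z, (2 * (D : ℝ≥0∞) * (heat d a z * sqNorm z)
            + 2 * D * (heat d b (x - z) * sqNorm (x - z))) := by
          refine ENNReal.tsum_le_tsum fun z => ?_
          have h1 : (sqNorm x : ℝ≥0) ≤ 2 * sqNorm z + 2 * sqNorm (x - z) := by
            exact_mod_cast sqNorm_le_two_mul_add x z
          have h2 : (sqNorm x : ℝ≥0) * (heat d a z * heat d b (x - z))
              ≤ 2 * D * (heat d a z * sqNorm z)
                + 2 * D * (heat d b (x - z) * sqNorm (x - z)) :=
            calc _ ≤ (2 * (sqNorm z : ℝ≥0) + 2 * sqNorm (x - z))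
                    * (heat d a z * heat d b (x - z)) := by gcongr
              _ = 2 * heat d b (x - z) * (heat d a z * sqNorm z)
                    + 2 * heat d a z * (heat d b (x - z) * sqNorm (x - z)) := by ring
              _ ≤ _ := by
                gcongr
                · exact hDb _
                · exact hDa _
          exact_mod_cast h2
      _ = 2 * D * n := by
          rw [ENNReal.tsum_add, ENNReal.tsum_mul_left, ENNReal.tsum_mul_left, hshift,
            tsum_heat_mul_sqNorm (by omega), ← mul_add, hab]
          push_cast
          rfl
  calc sqNorm x * heat d n x ≤ 2 * D * n := by exact_mod_cast hle
    _ ≤ 2 * D * (n + 1) := by gcongr; exact le_self_add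
    _ = 2 * A * 2 ^ d * invSqrt n ^ (d - 2) * ((n + 1) * invSqrt n ^ 2) := by
        rw [hD, mul_pow]
        nth_rw 2 [← Nat.sub_add_cancel hd]
        rw [pow_add _ (d - 2)]
        ring
    _ = _ := by rw [succ_mul_invSqrt_sq, mul_one]

/-- An upper bound for the Green's function `gSRW d 0`. -/
def green {d : ℕ} (x : Zd d) : ℝ≥0∞ := ∑' n, (heat d n x : ℝ≥0∞)

lemma gSRW_le_green {d : ℕ} (hd : 0 < d) (x : Zd d) : gSRW d 0 x ≤ green x :=
  ENNReal.tsum_le_tsum fun n => kpow_srwK_le_heat hd n x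

lemma exists_tail_le {d : ℕ} (hd : 3 ≤ d) :
    ∃ A : ℝ≥0, ∀ i (x : Zd d),
      ∑' n, (heat d (n + i) x : ℝ≥0∞) ≤ (A * invSqrt i ^ (d - 2) : ℝ≥0) := by
  obtain ⟨A, hA⟩ := exists_heat_le (d := d) (by omega)
  refine ⟨A * 4, fun i x => ENNReal.tsum_le_of_sum_range_le fun T => ?_⟩
  norm_cast
  calc ∑ n ∈ Finset.range T, heat d (n + i) x
      ≤ ∑ n ∈ Finset.range T, A * invSqrt (n + i) ^ d := Finset.sum_le_sum fun n _ => hA _ _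
    _ ≤ A * 4 * invSqrt i ^ (d - 2) := by
      rw [← Finset.mul_sum, mul_assoc]
      gcongr
      exact sum_invSqrt_pow_le hd i T

lemma exists_green_le {d : ℕ} (hd : 3 ≤ d) : ∃ A : ℝ≥0, ∀ x : Zd d, green x ≤ A := by
  obtain ⟨A, hA⟩ := exists_tail_le hd
  exact ⟨A, fun x => by simpa [invSqrt_zero, green] using hA 0 x⟩

lemma invSqrt_sq_le {m : ℕ} (hm : 0 < m) : invSqrt (m ^ 2) ≤ (m : ℝ≥0)⁻¹ := by
  unfold invSqrt
  gcongr
  rw [NNReal.le_sqrt_iff_sq_le]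
  push_cast
  exact le_self_add

lemma ENNReal.add_sq_le_four_mul (a b : ℝ≥0∞) : (a + b) ^ 2 ≤ 4 * (a ^ 2 + b ^ 2) := by
  wlog h : a ≤ b generalizing a b
  · rw [add_comm, add_comm (a ^ 2)]
    exact this b a (le_of_not_ge h)
  calc (a + b) ^ 2 ≤ (b + b) ^ 2 := by gcongr
    _ = 4 * b ^ 2 := by ring
    _ ≤ 4 * (a ^ 2 + b ^ 2) := by gcongr; exact le_add_self

lemma exists_tsum_sq_le {d : ℕ} (hd : 3 ≤ d) :
    ∃ A : ℝ≥0, ∀ T, ∑' x : Zd d, (∑ n ∈ Finset.range T, (heat d n x : ℝ≥0∞)) ^ 2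
      ≤ (A * ∑ i ∈ Finset.range T, invSqrt i ^ (d - 2) : ℝ≥0) := by
  obtain ⟨A, hA⟩ := exists_tail_le hd
  refine ⟨A, fun T => ?_⟩
  have h0 : ∀ i j, ∑' x : Zd d, (heat d i x : ℝ≥0∞) * heat d j x = heat d (j + i) 0 := by
    intro i j
    rw [add_comm j i, heat_add]
    simp only [zero_sub, heat_neg]
  calc ∑' x : Zd d, (∑ n ∈ Finset.range T, (heat d n x : ℝ≥0∞)) ^ 2
      = ∑ i ∈ Finset.range T, ∑ j ∈ Finset.range T, (heat d (j + i) 0 : ℝ≥0∞) := by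
        simp only [sq, Finset.sum_mul_sum]
        rw [Summable.tsum_finsetSum fun _ _ => ENNReal.summable]
        refine Finset.sum_congr rfl fun i _ => ?_
        rw [Summable.tsum_finsetSum fun _ _ => ENNReal.summable]
        exact Finset.sum_congr rfl fun j _ => h0 i j
    _ ≤ ∑ i ∈ Finset.range T, ((A * invSqrt i ^ (d - 2) : ℝ≥0) : ℝ≥0∞) :=
        Finset.sum_le_sum fun i _ => (ENNReal.sum_le_tsum _).trans (hA i 0)
    _ = _ := by
        rw [← ENNReal.ofNNReal_finsetSum, Finset.mul_sum]

lemma sqNorm_le_of_mem_lamF {d m : ℕ} {x : Zd d} (hx : x ∈ lamF d m) : sqNorm x ≤ d * m ^ 2 := by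
  rw [lamF, Fintype.mem_piFinset] at hx
  calc sqNorm x ≤ ∑ _i : Fin d, m ^ 2 := by
        refine Finset.sum_le_sum fun i _ => Nat.pow_le_pow_left ?_ 2
        have := Finset.mem_Icc.1 (hx i)
        omega
    _ = d * m ^ 2 := by simp

lemma card_lamF (d m : ℕ) : (lamF d m).card = (2 * m + 1) ^ d := by
  rw [lamF, Fintype.card_piFinset_const, Int.card_Icc]
  congr 1
  omega

lemma exists_green_bounds {d : ℕ} (hd : 3 ≤ d) (hd4 : d ≤ 4) (K : ℝ≥0) :
    ∃ C : ℝ≥0, ∀ (m : ℕ) (L : ℝ≥0), 0 < m →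
      ∑ n ∈ Finset.range (m ^ 2), invSqrt n ^ (d - 2) ≤ K * L →
      (m : ℝ≥0) ^ 2 * (m : ℝ≥0)⁻¹ ^ (d - 2) ≤ K * L →
      ∑ x ∈ lamF d m, green x ^ 2 ≤ (C * L : ℝ≥0) ∧
      ∀ x ∈ lamF d m, ((sqNorm x : ℝ≥0∞) + 1) * green x ^ 2 ≤ (C * L : ℝ≥0) := by
  obtain ⟨A, hA⟩ := exists_tail_le hd
  obtain ⟨G, hG⟩ := exists_green_le hd
  obtain ⟨B, hB⟩ := exists_sqNorm_mul_heat_le (d := d) (by omega)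
  obtain ⟨S, hS⟩ := exists_tsum_sq_le hd
  refine ⟨4 * (S * K + 3 ^ d * A ^ 2 * K) + G * ((B * K + d * A * K) + G * K),
    fun m L hm h1 h2 => ?_⟩
  have hm1 : (1 : ℝ≥0) ≤ m := by exact_mod_cast hm
  have hm0 : (m : ℝ≥0) ≠ 0 := by positivity
  have hKL : 1 ≤ K * L := by
    refine le_trans ?_ h2
    calc (1 : ℝ≥0) = (m : ℝ≥0) ^ 2 * (m : ℝ≥0)⁻¹ ^ 2 := by
          rw [← mul_pow, mul_inv_cancel₀ hm0, one_pow]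
      _ ≤ _ := by
          refine mul_le_mul' le_rfl ?_
          exact pow_le_pow_of_le_one zero_le (inv_le_one_of_one_le₀ hm1) (by omega)
  have hsplit : ∀ x : Zd d, green x = ∑ n ∈ Finset.range (m ^ 2), (heat d n x : ℝ≥0∞)
      + ∑' n, (heat d (n + m ^ 2) x : ℝ≥0∞) := fun x =>
    (Summable.sum_add_tsum_nat_add' ENNReal.summable).symm
  have htail : ∀ x : Zd d, ∑' n, (heat d (n + m ^ 2) x : ℝ≥0∞)
      ≤ (A * (m : ℝ≥0)⁻¹ ^ (d - 2) : ℝ≥0) := fun x => (hA _ x).trans (by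
    gcongr
    exact invSqrt_sq_le hm)
  constructor
  · calc ∑ x ∈ lamF d m, green x ^ 2
        ≤ ∑ x ∈ lamF d m, 4 * ((∑ n ∈ Finset.range (m ^ 2), (heat d n x : ℝ≥0∞)) ^ 2
            + ((A * (m : ℝ≥0)⁻¹ ^ (d - 2) : ℝ≥0) : ℝ≥0∞) ^ 2) := by
          refine Finset.sum_le_sum fun x _ => ?_
          rw [hsplit x]
          refine (ENNReal.add_sq_le_four_mul _ _).trans ?_
          gcongr
          exact htail x
      _ ≤ 4 * ((S * (K * L) : ℝ≥0) + (3 ^ d * A ^ 2 * (K * L) : ℝ≥0)) := by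
          rw [← Finset.mul_sum, Finset.sum_add_distrib]
          gcongr
          · refine (ENNReal.sum_le_tsum _).trans ((hS _).trans ?_)
            gcongr
          · rw [Finset.sum_const, card_lamF, nsmul_eq_mul]
            norm_cast
            push_cast
            have h3 : 2 * (m : ℝ≥0) + 1 ≤ 3 * m := by
              calc 2 * (m : ℝ≥0) + 1 ≤ 2 * m + m := by gcongr
                _ = 3 * m := by ring
            calc (2 * (m : ℝ≥0) + 1) ^ d * (A * (m : ℝ≥0)⁻¹ ^ (d - 2)) ^ 2
                ≤ (3 * m) ^ d * (A * (m : ℝ≥0)⁻¹ ^ (d - 2)) ^ 2 := by gcongr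
              _ = 3 ^ d * A ^ 2 * ((m : ℝ≥0) ^ 2 * (m : ℝ≥0)⁻¹ ^ (d - 2))
                    * ((m : ℝ≥0) * (m : ℝ≥0)⁻¹) ^ (d - 2) := by
                  rw [mul_pow 3]
                  nth_rw 2 [← Nat.sub_add_cancel (show 2 ≤ d by omega)]
                  rw [pow_add (m : ℝ≥0), mul_pow (m : ℝ≥0)]
                  ring
              _ ≤ 3 ^ d * A ^ 2 * (K * L) := by
                  rw [mul_inv_cancel₀ hm0, one_pow, mul_one]
                  gcongr
      _ ≤ _ := by
          norm_cast
          refine le_trans (le_of_eq ?_) (mul_le_mul_left le_self_add L)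
          ring
  · intro x hx
    have hx' : (sqNorm x : ℝ≥0) ≤ d * m ^ 2 := by exact_mod_cast sqNorm_le_of_mem_lamF hx
    have hnear : (sqNorm x : ℝ≥0∞) * ∑ n ∈ Finset.range (m ^ 2), (heat d n x : ℝ≥0∞)
        ≤ (B * (K * L) : ℝ≥0) := by
      norm_cast
      rw [Finset.mul_sum]
      refine (Finset.sum_le_sum fun n _ => hB n x).trans ?_
      rw [← Finset.mul_sum]
      gcongr
    have hfar : (sqNorm x : ℝ≥0∞) * ∑' n, (heat d (n + m ^ 2) x : ℝ≥0∞)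
        ≤ (d * A * (K * L) : ℝ≥0) := by
      refine (mul_le_mul_right (htail x) _).trans ?_
      norm_cast
      calc (sqNorm x : ℝ≥0) * (A * (m : ℝ≥0)⁻¹ ^ (d - 2))
          ≤ (d * m ^ 2) * (A * (m : ℝ≥0)⁻¹ ^ (d - 2)) := by gcongr
        _ = d * A * ((m : ℝ≥0) ^ 2 * (m : ℝ≥0)⁻¹ ^ (d - 2)) := by ring
        _ ≤ _ := by gcongr
    calc ((sqNorm x : ℝ≥0∞) + 1) * green x ^ 2
        = green x * (sqNorm x * green x + green x * 1) := by ring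
      _ ≤ G * (((B * (K * L) : ℝ≥0) + (d * A * (K * L) : ℝ≥0)) + G * (K * L : ℝ≥0)) := by
          have hone : (1 : ℝ≥0∞) ≤ (K * L : ℝ≥0) := by exact_mod_cast hKL
          have hmul : (sqNorm x : ℝ≥0∞) * green x
              ≤ (B * (K * L) : ℝ≥0) + (d * A * (K * L) : ℝ≥0) := by
            rw [hsplit x, mul_add]
            exact add_le_add hnear hfar
          exact mul_le_mul' (hG x) (add_le_add hmul (mul_le_mul' (hG x) hone))
      _ ≤ _ := by
          norm_cast
          refine le_trans (le_of_eq ?_) (mul_le_mul_left le_add_self L)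
          ring

lemma sum_invSqrt_le (T : ℕ) : ∑ n ∈ Finset.range T, invSqrt n ≤ 2 * NNReal.sqrt T := by
  induction T with
  | zero => simp
  | succ T ih =>
    rw [Finset.sum_range_succ]
    refine (add_le_add_left ih _).trans ?_
    rw [invSqrt, ← NNReal.coe_le_coe]
    push_cast
    have h1 := Real.sq_sqrt (show (0 : ℝ) ≤ T by positivity)
    have h2 := Real.sq_sqrt (show (0 : ℝ) ≤ (T : ℝ) + 1 by positivity)
    have hpos : 0 < √((T : ℝ) + 1) := Real.sqrt_pos.2 (by positivity)
    rw [← mul_le_mul_iff_of_pos_right hpos, add_mul, inv_mul_cancel₀ hpos.ne']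
    nlinarith [sq_nonneg (√((T : ℝ) + 1) - √T)]

lemma card_filter_znorm_sub_le {d : ℕ} (s : Finset (Zd d)) (r : ℝ) (y : Zd d) :
    (s.filter fun x => znorm (x - y) ≤ r).card ≤ (lamF d ⌈r⌉₊).card := by
  refine Finset.card_le_card_of_injOn (fun x => x - y) (fun x hx => ?_)
    fun a _ b _ h => sub_left_injective h
  have hx' := (Finset.mem_filter.1 (Finset.mem_coe.1 hx)).2
  rw [Finset.mem_coe, lamF, Fintype.mem_piFinset]
  intro i
  rw [Finset.mem_Icc, ← abs_le]
  have h1 : (((x - y) i : ℤ) : ℝ) ^ 2 ≤ znorm (x - y) ^ 2 := by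
    rw [znorm, Real.sq_sqrt (Finset.sum_nonneg fun i _ => sq_nonneg _)]
    exact Finset.single_le_sum (f := fun i => (((x - y) i : ℤ) : ℝ) ^ 2)
      (fun _ _ => sq_nonneg _) (Finset.mem_univ i)
  have h2 : |(((x - y) i : ℤ) : ℝ)| ≤ ⌈r⌉₊ :=
    (abs_le_of_sq_le_sq h1 (Real.sqrt_nonneg _)).trans (hx'.trans (Nat.le_ceil r))
  exact_mod_cast h2

lemma sum_range_sq_inv_le_log {m : ℕ} (hm : 2 ≤ m) :
    ∑ n ∈ Finset.range (m ^ 2), invSqrt n ^ 2 ≤ 4 * (Real.log m).toNNReal := by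
  have hlog : Real.log 2 ≤ Real.log m :=
    Real.log_le_log (by norm_num) (by exact_mod_cast hm)
  have h := harmonic_le_one_add_log (m ^ 2)
  rw [← NNReal.coe_le_coe]
  simp only [invSqrt_sq]
  push_cast [harmonic, Real.log_pow] at h ⊢
  rw [Real.coe_toNNReal _ (by linarith [Real.log_two_gt_d9])]
  linarith [Real.log_two_gt_d9]

lemma measurable_piT {d : ℕ} (x : Zd d) : Measurable fun ρ : Zd d → ℝ => piT ρ x := by
  unfold piT
  fun_prop

lemma measurable_smallTrap {d : ℕ} (R : ℝ) (x : Zd d) :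
    Measurable fun ρ : Zd d → ℝ => smallTrap R ρ x := by
  unfold smallTrap
  refine Measurable.ite (measurableSet_le ?_ measurable_const) measurable_const measurable_const
  fun_prop

lemma smallTrap_le_one {d : ℕ} (R : ℝ) (ρ : Zd d → ℝ) (x : Zd d) : smallTrap R ρ x ≤ 1 := by
  unfold smallTrap
  split_ifs <;> simp

lemma piT_mul_smallTrap_le {d : ℕ} {R : ℝ} (hR : 0 ≤ R) (ρ : Zd d → ℝ) (x : Zd d) :
    piT ρ x * smallTrap R ρ x ≤ R.toNNReal * (sqNorm x + 1) := by
  unfold smallTrap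
  split_ifs with h
  · have h1 : max (znorm x) 1 ^ 2 ≤ (sqNorm x : ℝ) + 1 := by
      rw [sqNorm_cast]
      rcases max_cases (znorm x) 1 with ⟨h, _⟩ | ⟨h, _⟩ <;> rw [h]
      · linarith
      · linarith [sq_nonneg (znorm x)]
    rw [mul_one, piT]
    refine (ENNReal.ofReal_le_ofReal (h.trans (mul_le_mul_of_nonneg_left h1 hR))).trans ?_
    rw [ENNReal.ofReal_mul hR, ENNReal.ofReal_add (by positivity) zero_le_one]
    simp [ENNReal.ofReal]
  · simp

lemma lintegral_piT_eq {d : ℕ} {P : Measure (Zd d → ℝ)}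
    (hstat : ∀ z : Zd d, P.map (fun ρ x => ρ (x + z)) = P) (y : Zd d) :
    ∫⁻ ρ, piT ρ y ∂P = ∫⁻ ρ, piT ρ 0 ∂P := by
  conv_rhs => rw [← hstat y]
  rw [lintegral_map (measurable_piT 0) (by fun_prop)]
  simp [piT]

/-- The second moment of the truncated Green function sum, in terms of bounds for the Green's
function on the box. -/
lemma exists_lintegral_le {d : ℕ} (hd : 0 < d) {P : Measure (Zd d → ℝ)}
    (hstat : ∀ z : Zd d, P.map (fun ρ x => ρ (x + z)) = P)
    (hint : ∫⁻ ρ, piT ρ 0 ∂P < ∞)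
    (hcorr : ∃ R₀ K₀ : ℝ, 0 < R₀ ∧ 0 < K₀ ∧ ∀ x y : Zd d, R₀ < znorm (x - y) →
      ∫⁻ ρ, piT ρ x * piT ρ y ∂P ≤ ENNReal.ofReal K₀) {R : ℝ} (hR : 0 < R) (C : ℝ≥0) :
    ∃ D : ℝ≥0, ∀ (m : ℕ) (L : ℝ≥0),
      ∑ x ∈ lamF d m, green x ^ 2 ≤ (C * L : ℝ≥0) →
      (∀ x ∈ lamF d m, ((sqNorm x : ℝ≥0∞) + 1) * green x ^ 2 ≤ (C * L : ℝ≥0)) →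
      ∫⁻ ρ, ∑ x ∈ lamF d m, ∑ y ∈ lamF d m,
          gSRW d 0 x ^ 2 * gSRW d 0 y ^ 2 * piT ρ x * piT ρ y *
            smallTrap R ρ x * smallTrap R ρ y ∂P ≤ (D * L ^ 2 : ℝ≥0) := by
  obtain ⟨R₀, K₀, hR₀, hK₀, hcorr⟩ := hcorr
  set M : ℝ≥0 := (∫⁻ ρ, piT ρ 0 ∂P).toNNReal with hMdef
  have hM : ∀ y, ∫⁻ ρ, piT ρ y ∂P = M := fun y => by
    rw [lintegral_piT_eq hstat, hMdef, ENNReal.coe_toNNReal hint.ne]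
  set N : ℕ := (lamF d ⌈R₀⌉₊).card with hN
  have hpair : ∀ x y : Zd d,
      ∫⁻ ρ, piT ρ x * piT ρ y * smallTrap R ρ x * smallTrap R ρ y ∂P
        ≤ K₀.toNNReal + (if znorm (x - y) ≤ R₀ then 1 else 0) *
          (R.toNNReal * (sqNorm x + 1) * M) := by
    intro x y
    split_ifs with h
    · refine le_add_left ?_
      rw [one_mul, ← hM y, ← lintegral_const_mul _ (measurable_piT y)]
      refine lintegral_mono fun ρ => ?_
      calc piT ρ x * piT ρ y * smallTrap R ρ x * smallTrap R ρ y
          ≤ piT ρ x * piT ρ y * smallTrap R ρ x * 1 := by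
            gcongr
            exact smallTrap_le_one R ρ y
        _ = piT ρ x * smallTrap R ρ x * piT ρ y := by ring
        _ ≤ _ := by
            exact mul_le_mul' (piT_mul_smallTrap_le hR.le ρ x) le_rfl
    · rw [zero_mul, add_zero]
      refine le_trans (lintegral_mono fun ρ => ?_) (hcorr x y (not_le.1 h))
      calc piT ρ x * piT ρ y * smallTrap R ρ x * smallTrap R ρ y
          ≤ piT ρ x * piT ρ y * 1 * 1 := by
            gcongr
            · exact smallTrap_le_one R ρ x
            · exact smallTrap_le_one R ρ y
        _ = _ := by ring
  refine ⟨K₀.toNNReal * C ^ 2 + R.toNNReal * M * N * C ^ 2, fun m L h1 h2 => ?_⟩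
  have hmeas : ∀ x y : Zd d, Measurable fun ρ : Zd d → ℝ =>
      piT ρ x * piT ρ y * smallTrap R ρ x * smallTrap R ρ y := fun x y =>
    (((measurable_piT x).mul (measurable_piT y)).mul (measurable_smallTrap R x)).mul
      (measurable_smallTrap R y)
  have hcount : ∀ y : Zd d, ∑ x ∈ lamF d m, (if znorm (x - y) ≤ R₀ then (1 : ℝ≥0∞) else 0)
      ≤ N := fun y => by
    rw [Finset.sum_boole]
    exact_mod_cast card_filter_znorm_sub_le _ _ _
  calc ∫⁻ ρ, ∑ x ∈ lamF d m, ∑ y ∈ lamF d m,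
          gSRW d 0 x ^ 2 * gSRW d 0 y ^ 2 * piT ρ x * piT ρ y *
            smallTrap R ρ x * smallTrap R ρ y ∂P
      ≤ ∫⁻ ρ, ∑ x ∈ lamF d m, ∑ y ∈ lamF d m, green x ^ 2 * green y ^ 2 *
          (piT ρ x * piT ρ y * smallTrap R ρ x * smallTrap R ρ y) ∂P := by
        refine lintegral_mono fun ρ => Finset.sum_le_sum fun x _ => Finset.sum_le_sum fun y _ => ?_
        simp only [← mul_assoc]
        gcongr <;> exact gSRW_le_green hd _
    _ = ∑ x ∈ lamF d m, ∑ y ∈ lamF d m, green x ^ 2 * green y ^ 2 *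
          ∫⁻ ρ, piT ρ x * piT ρ y * smallTrap R ρ x * smallTrap R ρ y ∂P := by
        rw [lintegral_finsetSum _ fun x _ => Finset.measurable_fun_sum _ fun y _ =>
          (hmeas x y).const_mul _]
        refine Finset.sum_congr rfl fun x _ => ?_
        rw [lintegral_finsetSum _ fun y _ => (hmeas x y).const_mul _]
        exact Finset.sum_congr rfl fun y _ => lintegral_const_mul _ (hmeas x y)
    _ ≤ ∑ x ∈ lamF d m, ∑ y ∈ lamF d m, (K₀.toNNReal * (green x ^ 2 * green y ^ 2) +
          R.toNNReal * M * (C * L : ℝ≥0) *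
            ((if znorm (x - y) ≤ R₀ then 1 else 0) * green y ^ 2)) := by
        refine Finset.sum_le_sum fun x hx => Finset.sum_le_sum fun y _ => ?_
        calc _ ≤ green x ^ 2 * green y ^ 2 * (K₀.toNNReal +
                (if znorm (x - y) ≤ R₀ then 1 else 0) *
                  (R.toNNReal * (sqNorm x + 1) * M)) := by
              gcongr
              exact hpair x y
          _ = K₀.toNNReal * (green x ^ 2 * green y ^ 2) +
                R.toNNReal * M * (((sqNorm x : ℝ≥0∞) + 1) * green x ^ 2) *
                  ((if znorm (x - y) ≤ R₀ then 1 else 0) * green y ^ 2) := by ring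
          _ ≤ _ := by
              gcongr
              exact h2 x hx
    _ = K₀.toNNReal * (∑ x ∈ lamF d m, green x ^ 2) ^ 2 + R.toNNReal * M * (C * L : ℝ≥0) *
          ∑ y ∈ lamF d m, (∑ x ∈ lamF d m, if znorm (x - y) ≤ R₀ then 1 else 0)
            * green y ^ 2 := by
        simp only [Finset.sum_add_distrib, ← Finset.mul_sum]
        rw [sq (∑ x ∈ _, _), Finset.sum_mul, Finset.sum_comm (s := lamF d m) (t := lamF d m)
          (f := fun x y => (if znorm (x - y) ≤ R₀ then (1 : ℝ≥0∞) else 0) * green y ^ 2)]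
        simp only [Finset.sum_mul]
    _ ≤ K₀.toNNReal * ((C * L : ℝ≥0) : ℝ≥0∞) ^ 2 + R.toNNReal * M * (C * L : ℝ≥0) *
          (N * (C * L : ℝ≥0)) := by
        gcongr
        calc _ ≤ ∑ y ∈ lamF d m, (N : ℝ≥0∞) * green y ^ 2 := by
              gcongr with y
              exact hcount y
          _ ≤ _ := by
              rw [← Finset.mul_sum]
              gcongr
    _ = _ := by
        norm_cast
        ring

theorem stmt11 (d : ℕ) (hd : d = 3 ∨ d = 4) (P : Measure (Zd d → ℝ))
    [IsProbabilityMeasure P]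
    (hrange : ∀ᵐ ρ ∂P, ∀ x, ρ x ∈ Set.Ico (0 : ℝ) 1)
    (hstat : ∀ z : Zd d, P.map (fun ρ x => ρ (x + z)) = P)
    (hint : ∫⁻ ρ, piT ρ 0 ∂P < ∞)
    (hcorr : ∃ R₀ K₀ : ℝ, 0 < R₀ ∧ 0 < K₀ ∧ ∀ x y : Zd d, R₀ < znorm (x - y) →
      ∫⁻ ρ, piT ρ x * piT ρ y ∂P ≤ ENNReal.ofReal K₀) :
    ∀ R : ℝ, 0 < R → ∃ c : ℝ, 0 < c ∧ ∀ m : ℕ, 2 ≤ m →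
      (d = 3 →
        ∫⁻ ρ, ∑ x ∈ lamF d m, ∑ y ∈ lamF d m,
            gSRW d 0 x ^ 2 * gSRW d 0 y ^ 2 * piT ρ x * piT ρ y *
              smallTrap R ρ x * smallTrap R ρ y ∂P
          ≤ ENNReal.ofReal (c * m ^ 2)) ∧
      (d = 4 →
        ∫⁻ ρ, ∑ x ∈ lamF d m, ∑ y ∈ lamF d m,
            gSRW d 0 x ^ 2 * gSRW d 0 y ^ 2 * piT ρ x * piT ρ y *
              smallTrap R ρ x * smallTrap R ρ y ∂P
          ≤ ENNReal.ofReal (c * Real.log m ^ 2)) := by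
  intro R hR
  have hd3 : 3 ≤ d := by omega
  obtain ⟨C, hC⟩ := exists_green_bounds hd3 (by omega) 4
  obtain ⟨D, hD⟩ := exists_lintegral_le (by omega) hstat hint hcorr hR C
  refine ⟨D + 1, by positivity, fun m hm => ⟨?_, ?_⟩⟩
  · rintro rfl
    obtain ⟨h1, h2⟩ := hC m m (by omega)
      (by
        simp only [Nat.reduceSub, pow_one]
        refine (sum_invSqrt_le _).trans ?_
        push_cast
        rw [NNReal.sqrt_sq]
        gcongr
        norm_num)
      (by
        have hm0 : (m : ℝ≥0) ≠ 0 := by positivity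
        rw [show 3 - 2 = 1 from rfl, pow_one, sq, mul_assoc, mul_inv_cancel₀ hm0, mul_one]
        exact le_mul_of_one_le_left zero_le (by norm_num))
    refine (hD m m h1 h2).trans ?_
    rw [← ENNReal.ofReal_coe_nnreal]
    refine ENNReal.ofReal_le_ofReal ?_
    push_cast
    gcongr
    linarith
  · rintro rfl
    have hlog : 0.6 ≤ Real.log m := by
      have : Real.log 2 ≤ Real.log m := Real.log_le_log (by norm_num) (by exact_mod_cast hm)
      linarith [Real.log_two_gt_d9]
    obtain ⟨h1, h2⟩ := hC m (Real.log m).toNNReal (by omega) (sum_range_sq_inv_le_log hm)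
      (by
        have hm0 : (m : ℝ≥0) ≠ 0 := by positivity
        rw [show 4 - 2 = 2 from rfl, ← mul_pow, mul_inv_cancel₀ hm0, one_pow, ← NNReal.coe_le_coe]
        push_cast
        rw [Real.coe_toNNReal _ (by linarith)]
        linarith)
    refine (hD m _ h1 h2).trans ?_
    rw [← ENNReal.ofReal_coe_nnreal]
    refine ENNReal.ofReal_le_ofReal ?_
    push_cast
    rw [Real.coe_toNNReal _ (by linarith)]
    gcongr
    linarith
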